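/- Let $p = (p_1,\dots,p_d)$ be a probability distribution with index of coincidence $\sum_k p_k^2 \le 1/v$ for some real $v$ with $1 \le v \le d$. Then the Shannon entropy satisfies $H(p) = -\sum_k p_k \log_2 p_k \ge \log_2(1+\lfloor v\rfloor) - \frac{\lfloor v\rfloor}{v}(1+\lfloor v\rfloor - v)\log_2\left(1+\frac{1}{\lfloor v\rfloor}\right)$. -/

import Mathlib

open scoped BigOperators

open Real in
/-- The binary entropy dominates the parabola through its zeros and its maximum. -/
theorem four_mul_log_two_mul_lt_negMulLog_add {u : ℝ} (h0 : 0 < u) (h1 : u < 1)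
    (hne : u ≠ 1 / 2) :
    4 * log 2 * (u * (1 - u)) < negMulLog u + negMulLog (1 - u) := by
  have series : ∀ x : ℝ, 0 < x → x < 1 →
      HasSum (fun n : ℕ => x ^ n / (n + 1)) (-log (1 - x) / x) := by
    intro x hx hx1
    have h := (hasSum_pow_div_log_of_abs_lt_one (x := x)
      (by rw [abs_of_pos hx]; exact hx1)).div_const x
    rw [show (fun n : ℕ => x ^ n / ((n : ℝ) + 1)) = fun n : ℕ => x ^ (n + 1) / ((n : ℝ) + 1) / x by
      ext n; rw [pow_succ]; field_simp]
    exact h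
  have hsum := (series u h0 h1).add (series (1 - u) (by linarith) (by linarith))
  have hhalf := (series (1 / 2) (by norm_num) (by norm_num)).add
    (series (1 / 2) (by norm_num) (by norm_num))
  have key := hasSum_lt (i := 2) (fun n => ?_) ?_ hhalf hsum
  · rw [show (1 : ℝ) - 1 / 2 = 2⁻¹ by norm_num, log_inv, sub_sub_cancel] at key
    have hu : (0 : ℝ) < u * (1 - u) := mul_pos h0 (by linarith)
    have h := mul_lt_mul_of_pos_right key hu
    have hu1 : (1 : ℝ) - u ≠ 0 := by linarith
    have e : (-log (1 - u) / u + -log u / (1 - u)) * (u * (1 - u))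
        = negMulLog u + negMulLog (1 - u) := by
      simp only [negMulLog]; field_simp; ring
    rw [e] at h
    linarith
  · simp only
    rw [← add_div, ← add_div]
    refine div_le_div_of_nonneg_right ?_ (by positivity)
    rcases n with _ | n
    · simp
    · have h := add_pow_le h0.le (by linarith : (0 : ℝ) ≤ 1 - u) (n + 1)
      rw [add_sub_cancel, one_pow, Nat.add_sub_cancel] at h
      have e : (1 / 2 : ℝ) ^ (n + 1) + (1 / 2) ^ (n + 1) = (1 / 2) ^ n := by ring
      rw [e, one_div, inv_pow, inv_eq_one_div, div_le_iff₀ (by positivity)]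
      linarith
  · have : 0 < (u - 1 / 2) ^ 2 := by
      have := sub_ne_zero.mpr hne
      positivity
    norm_num
    nlinarith

open Real in
/-- Among splittings of a fixed mass in two unequal positive parts, entropy plus a multiple of the
index of coincidence is never minimal. -/
theorem merge_lt_or_balance_lt (a : ℝ) {x y : ℝ} (hx : 0 < x) (hy : 0 < y) (hne : x ≠ y) :
    negMulLog (x + y) + a * (x + y) ^ 2 <
        negMulLog x + a * x ^ 2 + (negMulLog y + a * y ^ 2) ∨
      2 * (negMulLog ((x + y) / 2) + a * ((x + y) / 2) ^ 2) <
        negMulLog x + a * x ^ 2 + (negMulLog y + a * y ^ 2) := by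
  have ht : 0 < x + y := add_pos hx hy
  have h := four_mul_log_two_mul_lt_negMulLog_add (u := x / (x + y)) (by positivity)
    ((div_lt_one ht).2 (by linarith))
    (by rw [Ne, div_eq_div_iff ht.ne' two_ne_zero]; contrapose! hne; linarith)
  have e1 : 1 - x / (x + y) = y / (x + y) := by field_simp; ring
  rw [e1] at h
  simp only [negMulLog] at h ⊢
  rw [log_div hx.ne' ht.ne', log_div hy.ne' ht.ne'] at h
  rw [log_div ht.ne' two_ne_zero]
  have h' := mul_lt_mul_of_pos_right h ht
  have e2 : 4 * log 2 * (x / (x + y) * (y / (x + y))) * (x + y)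
      = 4 * log 2 * (x * y / (x + y)) := by field_simp
  have e3 : (-(x / (x + y)) * (log x - log (x + y)) + -(y / (x + y)) * (log y - log (x + y)))
      * (x + y) = -x * log x - y * log y + (x + y) * log (x + y) := by field_simp; ring
  rw [e2, e3] at h'
  have hlog : 0 < log 2 := log_pos one_lt_two
  set w := x * y / (x + y) with hw
  have hxy : x * y = w * (x + y) := by rw [hw]; field_simp
  have hw0 : 0 < w := by positivity
  have hw4 : 4 * w ≤ x + y := by
    rw [hw, mul_div_assoc', div_le_iff₀ ht]; nlinarith [sq_nonneg (x - y)]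
  rcases le_total (2 * a * (x + y)) (4 * log 2) with hb | hb
  · left
    nlinarith [mul_le_mul_of_nonneg_right hb hw0.le]
  · right
    nlinarith [mul_le_mul_of_nonneg_right hb (by linarith : 0 ≤ x + y - 4 * w)]

open Real in
/-- The chord of `k ↦ (1 / k, log k)` between `n` and `n + 1` lies below all its points. -/
theorem log_chord_le {n k : ℕ} (hn : 1 ≤ n) (hk : 1 ≤ k) :
    log (n + 1) + n * log (1 + 1 / n) ≤
      log k + n * (n + 1) * log (1 + 1 / n) * (1 / k) := by
  have hn0 : (0 : ℝ) < n := by exact_mod_cast hn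
  have hk0 : (0 : ℝ) < k := by exact_mod_cast hk
  have ec : log (1 + 1 / (n : ℝ)) = log (n + 1) - log n := by
    rw [← log_div (by positivity) hn0.ne']; congr 1; field_simp
  have hc_upper : n * log (1 + 1 / (n : ℝ)) ≤ 1 := by
    have := log_le_sub_one_of_pos (x := 1 + 1 / (n : ℝ)) (by positivity)
    calc n * log (1 + 1 / (n : ℝ)) ≤ n * (1 + 1 / (n : ℝ) - 1) := by gcongr
      _ = 1 := by field_simp; ring
  have hc_lower : 1 ≤ (n + 1) * log (1 + 1 / (n : ℝ)) := by
    have := one_sub_inv_le_log_of_pos (x := 1 + 1 / (n : ℝ)) (by positivity)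
    calc (1 : ℝ) = (n + 1) * (1 - (1 + 1 / (n : ℝ))⁻¹) := by field_simp; ring
      _ ≤ (n + 1) * log (1 + 1 / (n : ℝ)) := by gcongr
  set c := log (1 + 1 / (n : ℝ)) with hc
  rcases Nat.lt_or_ge n k with h | h
  · have h' : (n + 1 : ℝ) ≤ k := by exact_mod_cast h
    have hl := one_sub_inv_le_log_of_pos (x := k / (n + 1 : ℝ)) (by positivity)
    rw [log_div hk0.ne' (by positivity), inv_div] at hl
    have hr : (n + 1 : ℝ) / k ≤ 1 := (div_le_one hk0).2 h'
    have e : n * (n + 1) * c * (1 / k) = n * c * ((n + 1 : ℝ) / k) := by ring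
    rw [e]
    nlinarith
  · have h' : (k : ℝ) ≤ n := by exact_mod_cast h
    have hl := log_le_sub_one_of_pos (x := n / (k : ℝ)) (by positivity)
    rw [log_div hn0.ne' hk0.ne'] at hl
    have hr : 1 ≤ (n : ℝ) / k := (one_le_div hk0).2 h'
    have e : n * (n + 1) * c * (1 / k) = (n + 1) * c * ((n : ℝ) / k) := by ring
    rw [e]
    nlinarith

/-- Overwriting two coordinates changes a sum over all coordinates only through these two. -/
theorem sum_update_update {ι : Type*} [Fintype ι] [DecidableEq ι] (G : ℝ → ℝ) (q : ι → ℝ)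
    {i j : ι} (hij : i ≠ j) (x y : ℝ) :
    ∑ k, G (Function.update (Function.update q i x) j y k) =
      ∑ k, G (q k) + (G x - G (q i)) + (G y - G (q j)) := by
  have h := Fintype.sum_eq_add (f := fun k =>
    G (Function.update (Function.update q i x) j y k) - G (q k)) i j hij (by
      rintro k ⟨hi, hj⟩
      simp [hi, hj])
  simp only [Finset.sum_sub_distrib, Function.update_self, Function.update_of_ne hij] at h
  linarith

open Real in
/-- Entropy plus a multiple of the index of coincidence attains its minimum over the simplex at a
distribution that is uniform on its support. -/
theorem exists_uniform_min {ι : Type*} [Fintype ι] (a : ℝ) {p : ι → ℝ} (hp : p ∈ stdSimplex ℝ ι) :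
    ∃ q ∈ stdSimplex ℝ ι,
      (∀ i j, 0 < q i → 0 < q j → q i = q j) ∧
      ∑ k, (negMulLog (q k) + a * q k ^ 2) ≤ ∑ k, (negMulLog (p k) + a * p k ^ 2) := by
  classical
  obtain ⟨q, hq, hmin⟩ := (isCompact_stdSimplex ℝ ι).exists_isMinOn ⟨p, hp⟩
    (f := fun q => ∑ k, (negMulLog (q k) + a * q k ^ 2))
    (Continuous.continuousOn (by fun_prop))
  refine ⟨q, hq, fun i j hi hj => ?_, hmin hp⟩
  by_contra hne
  have hij : i ≠ j := fun h => hne (congrArg q h)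
  have no_improvement : ∀ x y : ℝ, 0 ≤ x → 0 ≤ y → x + y = q i + q j →
      negMulLog (q i) + a * q i ^ 2 + (negMulLog (q j) + a * q j ^ 2) ≤
        negMulLog x + a * x ^ 2 + (negMulLog y + a * y ^ 2) := by
    intro x y hx hy hxy
    have hmem : Function.update (Function.update q i x) j y ∈ stdSimplex ℝ ι := by
      refine ⟨fun k => ?_, ?_⟩
      · simp only [Function.update_apply]
        split_ifs
        exacts [hy, hx, hq.1 k]
      · have := sum_update_update id q hij x y
        simp only [id, hq.2] at this
        linarith
    have h := isMinOn_iff.1 hmin _ hmem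
    beta_reduce at h
    rw [sum_update_update (fun z => negMulLog z + a * z ^ 2) q hij] at h
    linarith
  rcases merge_lt_or_balance_lt a hi hj hne with h | h
  · have := no_improvement (q i + q j) 0 (by positivity) le_rfl (by ring)
    simp only [negMulLog_zero] at this
    linarith
  · have := no_improvement ((q i + q j) / 2) ((q i + q j) / 2) (by positivity) (by positivity)
      (by ring)
    linarith

open Real in
/-- The line through the points of the uniform distributions on `n` and `n + 1` outcomes bounds the
entropy (in nats) from below as a function of the index of coincidence. -/
theorem le_entropy_add_index_of_coincidence {ι : Type*} [Fintype ι] {p : ι → ℝ}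
    (hp : p ∈ stdSimplex ℝ ι) {n : ℕ} (hn : 1 ≤ n) :
    log (n + 1) + n * log (1 + 1 / n) ≤
      ∑ k, negMulLog (p k) + n * (n + 1) * log (1 + 1 / n) * ∑ k, p k ^ 2 := by
  obtain ⟨q, hq, huni, hle⟩ := exists_uniform_min (n * (n + 1) * log (1 + 1 / (n : ℝ))) hp
  rw [Finset.mul_sum, ← Finset.sum_add_distrib]
  refine le_trans ?_ hle
  suffices h : ∑ i, q i * (log (n + 1) + n * log (1 + 1 / (n : ℝ))) ≤
      ∑ k, (negMulLog (q k) + n * (n + 1) * log (1 + 1 / (n : ℝ)) * q k ^ 2) by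
    rwa [← Finset.sum_mul, hq.2, one_mul] at h
  refine Finset.sum_le_sum fun i _ => ?_
  rcases (hq.1 i).eq_or_lt with h0 | hpos
  · simp [← h0]
  · have hcard : (({k | 0 < q k} : Finset ι).card : ℝ) * q i = 1 := by
      rw [← hq.2, ← nsmul_eq_mul, ← Finset.sum_const, Finset.sum_filter]
      refine Finset.sum_congr rfl fun k _ => ?_
      split_ifs with hk
      · exact huni i k hpos hk
      · exact le_antisymm (hq.1 k) (not_lt.1 hk)
    have hk : 1 ≤ ({k | 0 < q k} : Finset ι).card :=
      Finset.card_pos.2 ⟨i, by simpa using hpos⟩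
    have h := log_chord_le hn hk
    have hinv := eq_one_div_of_mul_eq_one_right hcard
    have hlog : log (q i) = -log ({k | 0 < q k} : Finset ι).card := by
      rw [hinv, one_div, log_inv]
    rw [← hinv] at h
    have := mul_le_mul_of_nonneg_right h hpos.le
    rw [negMulLog, hlog]
    linarith

/-- Sánchez-Ruiz entropy lower bound in terms of the index of coincidence:
if ∑ pₖ² ≤ 1/v with 1 ≤ v ≤ d, then
H(p) ≥ log₂(1+⌊v⌋) − (⌊v⌋/v)(1+⌊v⌋−v) log₂(1+1/⌊v⌋). -/
theorem entropy_lower_bound_index_of_coincidence (d : ℕ)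
    (p : Fin d → ℝ) (hp0 : ∀ k, 0 ≤ p k) (hp1 : ∑ k, p k = 1)
    (v : ℝ) (hv1 : 1 ≤ v) (hvd : v ≤ d)
    (hioc : ∑ k, (p k) ^ 2 ≤ 1 / v) :
    -∑ k, p k * Real.logb 2 (p k) ≥
      Real.logb 2 (1 + (⌊v⌋ : ℝ)) -
        ((⌊v⌋ : ℝ) / v) * (1 + (⌊v⌋ : ℝ) - v) * Real.logb 2 (1 + 1 / (⌊v⌋ : ℝ)) := by
  obtain ⟨n, hnv⟩ := Int.eq_ofNat_of_zero_le (Int.floor_nonneg.2 (zero_le_one.trans hv1))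
  have hn : 1 ≤ n := by
    have : 1 ≤ ⌊v⌋ := Int.le_floor.2 (by exact_mod_cast hv1)
    omega
  have hv0 : 0 < v := by linarith
  have key := le_entropy_add_index_of_coincidence (p := p) ⟨hp0, hp1⟩ hn
  have hc : 0 ≤ Real.log (1 + 1 / (n : ℝ)) :=
    Real.log_nonneg (le_add_of_nonneg_right (by positivity))
  have hS := mul_le_mul_of_nonneg_left hioc
    (by positivity : 0 ≤ n * (n + 1) * Real.log (1 + 1 / (n : ℝ)))
  have hlog2 : 0 < Real.log 2 := Real.log_pos one_lt_two
  have hH : -∑ k, p k * Real.logb 2 (p k) = (∑ k, Real.negMulLog (p k)) / Real.log 2 := by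
    rw [Finset.sum_div, ← Finset.sum_neg_distrib]
    refine Finset.sum_congr rfl fun k _ => ?_
    simp only [Real.negMulLog, Real.logb]
    ring
  have hcoef : (n : ℝ) / v * (1 + n - v) = n * (n + 1) * (1 / v) - n := by field_simp; ring
  rw [hnv, hH, Int.cast_natCast, hcoef, Real.logb, Real.logb, mul_div_assoc', ← sub_div, ge_iff_le,
    add_comm 1 (n : ℝ)]
  refine div_le_div_of_nonneg_right ?_ hlog2.le
  linarith
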